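/- Let Φ be an N×D real matrix with rank Φ = D and let Ψ = Φ W for some D×d matrix W, where Ψ has rank d. Let Π_F := Φ (Φᵀ D_μ Φ)⁻¹ Φᵀ D_μ and Π_G := Ψ (Ψᵀ D_μ Ψ)⁻¹ Ψᵀ D_μ. Let V ∈ ℝ^N satisfy V = r + γ P V and let V̄ ∈ ℝ^N satisfy V̄ = Π_G T^λ V̄. Then ‖V − V̄‖_μ ≤ ((1−λγ)/(1−γ)) ( ‖V − Π_F V‖_μ + ‖Π_F V − Π_G (Π_F V)‖_μ ). -/

import Mathlib

open Matrix

/-- The norm weighted by `μ` on functions on a finite type. -/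
noncomputable def weightedNorm {ι : Type*} [Fintype ι] (μ v : ι → ℝ) : ℝ :=
  Real.sqrt (∑ x, μ x * v x ^ 2)

/-- The `μ`-orthogonal projection onto the column space of `Ψ`,
when the Gram matrix is invertible. -/
noncomputable def weightedProj {ι κ : Type*} [Fintype ι] [DecidableEq ι] [Fintype κ] [DecidableEq κ]
    (μ : ι → ℝ) (Ψ : Matrix ι κ ℝ) : Matrix ι ι ℝ :=
  Ψ * (Ψᵀ * diagonal μ * Ψ)⁻¹ * Ψᵀ * diagonal μ

section

variable {ι κ : Type*} [Fintype ι] {μ : ι → ℝ}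

lemma weightedNorm_nonneg (v : ι → ℝ) : 0 ≤ weightedNorm μ v := Real.sqrt_nonneg _

lemma weightedNorm_eq_norm (hμ : ∀ x, 0 ≤ μ x) (v : ι → ℝ) :
    weightedNorm μ v = ‖WithLp.toLp 2 (fun x => Real.sqrt (μ x) * v x)‖ := by
  rw [weightedNorm, EuclideanSpace.norm_eq]
  congr 1
  refine Finset.sum_congr rfl fun x _ => ?_
  simp only [Real.norm_eq_abs, sq_abs, mul_pow, Real.sq_sqrt (hμ x)]

lemma weightedNorm_add_le (hμ : ∀ x, 0 ≤ μ x) (u v : ι → ℝ) :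
    weightedNorm μ (u + v) ≤ weightedNorm μ u + weightedNorm μ v := by
  simp only [weightedNorm_eq_norm hμ]
  refine le_of_eq_of_le ?_ (norm_add_le _ _)
  congr 1
  ext x
  simp [mul_add]

lemma weightedNorm_smul {c : ℝ} (hc : 0 ≤ c) (v : ι → ℝ) :
    weightedNorm μ (c • v) = c * weightedNorm μ v := by
  have h : ∑ x, μ x * (c • v) x ^ 2 = c ^ 2 * ∑ x, μ x * v x ^ 2 := by
    rw [Finset.mul_sum]
    refine Finset.sum_congr rfl fun x _ => ?_
    simp only [Pi.smul_apply, smul_eq_mul]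
    ring
  rw [weightedNorm, h, Real.sqrt_mul (sq_nonneg c), Real.sqrt_sq hc, weightedNorm]

lemma eq_zero_of_weightedNorm_le_zero (hμ : ∀ x, 0 < μ x) {v : ι → ℝ}
    (hv : weightedNorm μ v ≤ 0) : v = 0 := by
  have hnn : ∀ x ∈ Finset.univ, 0 ≤ μ x * v x ^ 2 :=
    fun x _ => mul_nonneg (hμ x).le (sq_nonneg _)
  have h0 := (Finset.sum_eq_zero_iff_of_nonneg hnn).1
    (le_antisymm (Real.sqrt_eq_zero'.1 (le_antisymm hv (Real.sqrt_nonneg _)))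
      (Finset.sum_nonneg hnn))
  funext x
  simpa [(hμ x).ne'] using h0 x (Finset.mem_univ x)

lemma weightedNorm_mulVec_le_of_stationary (hμ : ∀ x, 0 ≤ μ x) {P : Matrix ι ι ℝ}
    (hP0 : ∀ x y, 0 ≤ P x y) (hP1 : ∀ x, ∑ y, P x y = 1)
    (hstat : ∀ y, ∑ x, μ x * P x y = μ y) (v : ι → ℝ) :
    weightedNorm μ (P *ᵥ v) ≤ weightedNorm μ v := by
  refine Real.sqrt_le_sqrt ?_
  calc ∑ x, μ x * (P *ᵥ v) x ^ 2 ≤ ∑ x, μ x * ∑ y, P x y * v y ^ 2 := by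
        refine Finset.sum_le_sum fun x _ => mul_le_mul_of_nonneg_left ?_ (hμ x)
        have := (even_two.convexOn_pow (𝕜 := ℝ)).map_sum_le (t := Finset.univ) (w := P x)
          (p := v) (fun y _ => hP0 x y) (hP1 x) (fun _ _ => Set.mem_univ _)
        simpa [mulVec, dotProduct] using this
    _ = ∑ y, μ y * v y ^ 2 := by
        simp_rw [Finset.mul_sum]
        rw [Finset.sum_comm]
        refine Finset.sum_congr rfl fun y _ => ?_
        rw [← hstat y, Finset.sum_mul]
        exact Finset.sum_congr rfl fun x _ => by ring

lemma weightedNorm_le_of_sub_smul_mulVec_eq (hμ : ∀ x, 0 ≤ μ x) {P : Matrix ι ι ℝ}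
    (hP0 : ∀ x y, 0 ≤ P x y) (hP1 : ∀ x, ∑ y, P x y = 1)
    (hstat : ∀ y, ∑ x, μ x * P x y = μ y) {c : ℝ} (hc : 0 ≤ c) {u w : ι → ℝ}
    (h : w - c • P *ᵥ w = u) :
    (1 - c) * weightedNorm μ w ≤ weightedNorm μ u := by
  have h1 : w = u + c • P *ᵥ w := by rw [← h]; abel
  have h2 := weightedNorm_add_le hμ u (c • P *ᵥ w)
  rw [← h1, weightedNorm_smul hc] at h2
  nlinarith [weightedNorm_mulVec_le_of_stationary hμ hP0 hP1 hstat w]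

variable [DecidableEq ι]

lemma weightedNorm_mulVec_le_of_transpose_mul (hμ : ∀ x, 0 ≤ μ x) {Q : Matrix ι ι ℝ}
    (hQ : Qᵀ * diagonal μ * Q = diagonal μ * Q) (u : ι → ℝ) :
    weightedNorm μ (Q *ᵥ u) ≤ weightedNorm μ u := by
  refine Real.sqrt_le_sqrt ?_
  have h1 : (Q *ᵥ u) ⬝ᵥ (diagonal μ *ᵥ (Q *ᵥ u)) = u ⬝ᵥ (diagonal μ *ᵥ (Q *ᵥ u)) := by
    rw [mulVec_mulVec _ (diagonal μ) Q, ← hQ, ← mulVec_mulVec, ← mulVec_mulVec,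
      dotProduct_mulVec u, vecMul_transpose, mulVec_mulVec, mulVec_mulVec, hQ, mulVec_mulVec]
  have h2 : ∑ x, μ x * (Q *ᵥ u) x ^ 2 = ∑ x, μ x * (u x * (Q *ᵥ u) x) := by
    simp only [dotProduct, mulVec_diagonal] at h1
    calc _ = _ := Finset.sum_congr rfl fun x _ => by ring
      _ = _ := h1
      _ = _ := Finset.sum_congr rfl fun x _ => by ring
  have h3 : 0 ≤ ∑ x, μ x * (u x - (Q *ᵥ u) x) ^ 2 :=
    Finset.sum_nonneg fun x _ => mul_nonneg (hμ x) (sq_nonneg _)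
  have h4 : ∑ x, μ x * (u x - (Q *ᵥ u) x) ^ 2 = ∑ x, μ x * u x ^ 2
      - 2 * ∑ x, μ x * (u x * (Q *ᵥ u) x) + ∑ x, μ x * (Q *ᵥ u) x ^ 2 := by
    rw [Finset.mul_sum, ← Finset.sum_sub_distrib, ← Finset.sum_add_distrib]
    exact Finset.sum_congr rfl fun x _ => by ring
  linarith

lemma isUnit_det_gram [Fintype κ] [DecidableEq κ] (hμ : ∀ x, 0 < μ x)
    {Ψ : Matrix ι κ ℝ} (hΨ : Ψ.rank = Fintype.card κ) :
    IsUnit (Ψᵀ * diagonal μ * Ψ).det := by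
  have hinj : Function.Injective Ψ.mulVec := by
    rw [mulVec_injective_iff, linearIndependent_iff_card_eq_finrank_span, ← hΨ,
      rank_eq_finrank_span_cols]
    rfl
  have := ((PosDef.diagonal hμ).conjTranspose_mul_mul_same hinj).det_pos
  rw [conjTranspose_eq_transpose_of_trivial] at this
  exact this.ne'.isUnit

lemma weightedNorm_weightedProj_mulVec_le [Fintype κ] [DecidableEq κ] (hμ : ∀ x, 0 < μ x)
    {Ψ : Matrix ι κ ℝ} (hΨ : Ψ.rank = Fintype.card κ) (u : ι → ℝ) :
    weightedNorm μ (weightedProj μ Ψ *ᵥ u) ≤ weightedNorm μ u := by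
  refine weightedNorm_mulVec_le_of_transpose_mul (fun x => (hμ x).le) ?_ u
  have hG := isUnit_det_gram hμ hΨ
  rw [weightedProj]
  simp only [transpose_mul, transpose_nonsing_inv, diagonal_transpose, transpose_transpose]
  rw [← Matrix.mul_assoc Ψᵀ (diagonal μ) Ψ]
  calc _ = diagonal μ * Ψ * (Ψᵀ * diagonal μ * Ψ)⁻¹ *
        ((Ψᵀ * diagonal μ * Ψ) * (Ψᵀ * diagonal μ * Ψ)⁻¹) * Ψᵀ * diagonal μ := by
        simp only [Matrix.mul_assoc]
    _ = _ := by
        rw [mul_nonsing_inv _ hG, Matrix.mul_one]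
        simp only [Matrix.mul_assoc]

lemma weightedProj_mul_weightedProj [Fintype κ] [DecidableEq κ] {κ' : Type*} [Fintype κ']
    [DecidableEq κ'] (hμ : ∀ x, 0 < μ x) {Φ : Matrix ι κ ℝ} (hΦ : Φ.rank = Fintype.card κ)
    (W : Matrix κ κ' ℝ) :
    weightedProj μ (Φ * W) * weightedProj μ Φ = weightedProj μ (Φ * W) := by
  have h : (Φ * W)ᵀ * diagonal μ * weightedProj μ Φ = (Φ * W)ᵀ * diagonal μ := by
    calc _ = Wᵀ * ((Φᵀ * diagonal μ * Φ) * (Φᵀ * diagonal μ * Φ)⁻¹) * Φᵀ * diagonal μ := by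
          simp only [weightedProj, transpose_mul, Matrix.mul_assoc]
      _ = _ := by
          rw [mul_nonsing_inv _ (isUnit_det_gram hμ hΦ), Matrix.mul_one, transpose_mul]
  rw [weightedProj, Matrix.mul_assoc _ (Φ * W)ᵀ, Matrix.mul_assoc, h]

lemma isUnit_one_sub_smul_of_stationary (hμ : ∀ x, 0 < μ x) {P : Matrix ι ι ℝ}
    (hP0 : ∀ x y, 0 ≤ P x y) (hP1 : ∀ x, ∑ y, P x y = 1)
    (hstat : ∀ y, ∑ x, μ x * P x y = μ y) {c : ℝ} (hc : 0 ≤ c) (hc1 : c < 1) :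
    IsUnit (1 - c • P) := by
  rw [← mulVec_injective_iff_isUnit, ← coe_mulVecLin, ← LinearMap.ker_eq_bot,
    LinearMap.ker_eq_bot']
  intro w hw
  have hw' : w - c • P *ᵥ w = 0 := by
    simpa [sub_mulVec, smul_mulVec] using hw
  have h := weightedNorm_le_of_sub_smul_mulVec_eq (fun x => (hμ x).le) hP0 hP1 hstat hc hw'
  have h0 : weightedNorm μ (0 : ι → ℝ) = 0 := by simp [weightedNorm]
  rw [h0] at h
  exact eq_zero_of_weightedNorm_le_zero hμ (by nlinarith [sub_pos.2 hc1])

end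

/-- Approximation error bound for LSTD(λ)-RP: if `V = r + γ P V` and
`V̄ = Π_G T^λ V̄`, then
`‖V - V̄‖_μ ≤ ((1-λγ)/(1-γ)) (‖V - Π_F V‖_μ + ‖Π_F V - Π_G (Π_F V)‖_μ)`. -/
theorem stmt_16 (NN D d : ℕ) (hN : 1 ≤ NN)
    (μ : Fin NN → ℝ) (hμpos : ∀ x, 0 < μ x) (hμsum : ∑ x, μ x = 1)
    (P : Matrix (Fin NN) (Fin NN) ℝ)
    (hP0 : ∀ x y, 0 ≤ P x y) (hP1 : ∀ x, ∑ y, P x y = 1)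
    (hstat : ∀ y, ∑ x, μ x * P x y = μ y)
    (γ lam : ℝ) (hγ : γ ∈ Set.Ioo (0 : ℝ) 1) (hlam : lam ∈ Set.Ico (0 : ℝ) 1)
    (r : Fin NN → ℝ)
    (Φ : Matrix (Fin NN) (Fin D) ℝ) (hΦ : Φ.rank = D)
    (W : Matrix (Fin D) (Fin d) ℝ)
    (Ψ : Matrix (Fin NN) (Fin d) ℝ) (hΨW : Ψ = Φ * W) (hΨ : Ψ.rank = d)
    (Tlam : (Fin NN → ℝ) → (Fin NN → ℝ))
    (hTlam : ∀ v, Tlam v =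
      ((1 : Matrix (Fin NN) (Fin NN) ℝ) - (lam * γ) • P)⁻¹.mulVec r +
        ((1 - lam) * γ) •
          P.mulVec (((1 : Matrix (Fin NN) (Fin NN) ℝ) - (lam * γ) • P)⁻¹.mulVec v))
    (PiF PiG : Matrix (Fin NN) (Fin NN) ℝ)
    (hPiF : PiF = Φ * (Φᵀ * Matrix.diagonal μ * Φ)⁻¹ * Φᵀ * Matrix.diagonal μ)
    (hPiG : PiG = Ψ * (Ψᵀ * Matrix.diagonal μ * Ψ)⁻¹ * Ψᵀ * Matrix.diagonal μ)
    (V Vbar : Fin NN → ℝ)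
    (hV : V = r + γ • P.mulVec V)
    (hVbar : Vbar = PiG.mulVec (Tlam Vbar)) :
    Real.sqrt (∑ x, μ x * (V x - Vbar x) ^ 2) ≤
      ((1 - lam * γ) / (1 - γ)) *
        (Real.sqrt (∑ x, μ x * (V x - PiF.mulVec V x) ^ 2) +
          Real.sqrt (∑ x,
            μ x * (PiF.mulVec V x - PiG.mulVec (PiF.mulVec V) x) ^ 2)) := by
  have hμ0 : ∀ x, 0 ≤ μ x := fun x => (hμpos x).le
  obtain ⟨hγ0, hγ1⟩ := hγ
  obtain ⟨hl0, hl1⟩ := hlam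
  have hc0 : 0 ≤ lam * γ := by positivity
  have hc1 : lam * γ < 1 := by nlinarith
  have hA := (isUnit_iff_isUnit_det _).1
    (isUnit_one_sub_smul_of_stationary hμpos hP0 hP1 hstat hc0 hc1)
  set A : Matrix (Fin NN) (Fin NN) ℝ := 1 - (lam * γ) • P with hAdef
  have hAmul (w : Fin NN → ℝ) : A *ᵥ w = w - (lam * γ) • P *ᵥ w := by
    rw [hAdef, sub_mulVec, one_mulVec, smul_mulVec]
  have hAinv (w : Fin NN → ℝ) : A *ᵥ (A⁻¹ *ᵥ w) = w := by
    rw [mulVec_mulVec, mul_nonsing_inv _ hA, one_mulVec]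
  have hcomm : A * P = P * A := by
    rw [hAdef]; simp [sub_mul, mul_sub]
  have hfix : Tlam V = V := by
    rw [hTlam]
    refine mulVec_injective_of_isUnit ((isUnit_iff_isUnit_det _).2 hA) ?_
    rw [mulVec_add, mulVec_smul, hAinv, mulVec_mulVec _ A P, hcomm, ← mulVec_mulVec, hAinv, hAmul]
    nth_rewrite 2 [hV]
    module
  have hdiff : Tlam V - Tlam Vbar = ((1 - lam) * γ) • P *ᵥ (A⁻¹ *ᵥ (V - Vbar)) := by
    rw [hTlam, hTlam, mulVec_sub, mulVec_sub]
    module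
  have hG : PiG = weightedProj μ (Φ * W) := by rw [hPiG, hΨW]; rfl
  have hF : PiF = weightedProj μ Φ := hPiF
  have hGF : PiG *ᵥ (PiF *ᵥ V) = PiG *ᵥ V := by
    rw [mulVec_mulVec, hG, hF, weightedProj_mul_weightedProj hμpos (by simpa using hΦ)]
  have hcontr : (1 - lam * γ) * weightedNorm μ (PiG *ᵥ (Tlam V - Tlam Vbar)) ≤
      (1 - lam) * γ * weightedNorm μ (V - Vbar) := by
    have hk : 0 ≤ (1 - lam) * γ := mul_nonneg (by linarith) hγ0.le
    have h1 := weightedNorm_weightedProj_mulVec_le hμpos (Ψ := Φ * W)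
      (by simpa [hΨW] using hΨ) (Tlam V - Tlam Vbar)
    rw [← hG] at h1
    have h2 : weightedNorm μ (Tlam V - Tlam Vbar) =
        (1 - lam) * γ * weightedNorm μ (P *ᵥ (A⁻¹ *ᵥ (V - Vbar))) := by
      rw [hdiff, weightedNorm_smul hk]
    have h3 := weightedNorm_mulVec_le_of_stationary hμ0 hP0 hP1 hstat (A⁻¹ *ᵥ (V - Vbar))
    have h4 := weightedNorm_le_of_sub_smul_mulVec_eq hμ0 hP0 hP1 hstat hc0
      ((hAmul _).symm.trans (hAinv (V - Vbar)))
    calc _ ≤ (1 - lam * γ) * ((1 - lam) * γ * weightedNorm μ (A⁻¹ *ᵥ (V - Vbar))) := by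
          refine mul_le_mul_of_nonneg_left ?_ (by linarith)
          exact (h1.trans_eq h2).trans (mul_le_mul_of_nonneg_left h3 hk)
      _ = (1 - lam) * γ * ((1 - lam * γ) * weightedNorm μ (A⁻¹ *ᵥ (V - Vbar))) := by ring
      _ ≤ _ := mul_le_mul_of_nonneg_left h4 hk
  have hsplit : V - Vbar = (V - PiF *ᵥ V) + (PiF *ᵥ V - PiG *ᵥ (PiF *ᵥ V)) +
      PiG *ᵥ (Tlam V - Tlam Vbar) := by
    rw [mulVec_sub, ← hVbar, hfix, hGF]
    abel
  have htri := (weightedNorm_add_le hμ0 ((V - PiF *ᵥ V) + (PiF *ᵥ V - PiG *ᵥ (PiF *ᵥ V)))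
    (PiG *ᵥ (Tlam V - Tlam Vbar))).trans
      (add_le_add_left (weightedNorm_add_le hμ0 (V - PiF *ᵥ V) _) _)
  rw [← hsplit] at htri
  change weightedNorm μ (V - Vbar) ≤ (1 - lam * γ) / (1 - γ) *
    (weightedNorm μ (V - PiF *ᵥ V) + weightedNorm μ (PiF *ᵥ V - PiG *ᵥ (PiF *ᵥ V)))
  rw [div_mul_eq_mul_div, le_div_iff₀ (by linarith)]
  linarith [mul_le_mul_of_nonneg_left htri (sub_pos.2 hc1).le]
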